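/- Let H be a complex Hilbert space, let I be a subinterval of (0,∞), and let f : I → (0,∞) be a continuous operator geometrically convex function. Then for all commuting positive invertible bounded operators A, B on H with spectra contained in I: f(√(AB)) ≤ ∫_0^1 ( f(A^t B^(1−t)) · f(A^(1−t) B^t) )^(1/2) dt ≤ ( f(A) · f(B) )^(1/2) in the operator order, where the integral is the Bochner integral of the operator-valued function on [0,1] and square roots of products of commuting positive operators are taken via the continuous functional calculus. -/

import Mathlib

open MeasureTheory Set Filter Topology

/-- If an order-connected set contains the spectra of two selfadjoint elements, then it contains
a compact interval around both of them. -/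
theorem IsSelfAdjoint.exists_spectrum_subset_Icc_subset {𝒜 : Type*} [CStarAlgebra 𝒜]
    [Nontrivial 𝒜] {a b : 𝒜}
    (ha : IsSelfAdjoint a) {I : Set ℝ} (hI : I.OrdConnected)
    (hsa : spectrum ℝ a ⊆ I) (hsb : spectrum ℝ b ⊆ I) :
    ∃ m ∈ I, ∃ M ∈ I, spectrum ℝ a ⊆ Icc m M ∧ spectrum ℝ b ⊆ Icc m M ∧ Icc m M ⊆ I := by
  have hK : IsCompact (spectrum ℝ a ∪ spectrum ℝ b) :=
    (spectrum.isCompact a).union (spectrum.isCompact b)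
  have hne : (spectrum ℝ a ∪ spectrum ℝ b).Nonempty :=
    (ContinuousFunctionalCalculus.spectrum_nonempty a ha).inl
  obtain ⟨m, hm, hlow⟩ := hK.exists_isLeast hne
  obtain ⟨M, hM, hupp⟩ := hK.exists_isGreatest hne
  have hsub : spectrum ℝ a ∪ spectrum ℝ b ⊆ I := union_subset hsa hsb
  exact ⟨m, hsub hm, M, hsub hM, fun x hx ↦ ⟨hlow (.inl hx), hupp (.inl hx)⟩,
    fun x hx ↦ ⟨hlow (.inr hx), hupp (.inr hx)⟩, hI.out (hsub hm) (hsub hM)⟩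

section CStarAlgebra

variable {𝒜 : Type*} [CStarAlgebra 𝒜] [PartialOrder 𝒜] [StarOrderedRing 𝒜]

/-- Real powers of commuting elements commute. -/
theorem Commute.cfcRpow {a b : 𝒜} (h : Commute a b) (x y : ℝ) :
    Commute (a ^ x) (b ^ y) :=
  ((h.cfc_nnreal (fun r ↦ r ^ x)).symm.cfc_nnreal (fun r ↦ r ^ y)).symm

/-- Multiplication is monotone on positive elements that commute suitably. -/
theorem Commute.cfc_mul_le_mul {a b c d : 𝒜} (ha : 0 ≤ a) (hd : 0 ≤ d) (hac : a ≤ c)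
    (hbd : b ≤ d) (hab : Commute a b) (had : Commute a d) (hcd : Commute c d) :
    a * b ≤ c * d := by
  have hleft : 0 ≤ a * (d - b) :=
    (had.sub_right hab).mul_nonneg ha (sub_nonneg.2 hbd)
  have hright : 0 ≤ (c - a) * d :=
    (hcd.sub_left had).mul_nonneg (sub_nonneg.2 hac) hd
  rw [mul_sub, sub_nonneg] at hleft
  rw [sub_mul, sub_nonneg] at hright
  exact hleft.trans hright

theorem CFC.sqrt_mul_of_commute {a b : 𝒜} (ha : 0 ≤ a) (hb : 0 ≤ b) (h : Commute a b) :
    CFC.sqrt (a * b) = a ^ (1 / 2 : ℝ) * b ^ (1 / 2 : ℝ) := by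
  have hc := h.cfcRpow (1 / 2) (1 / 2)
  refine CFC.sqrt_unique ?_ (hc.mul_nonneg CFC.rpow_nonneg CFC.rpow_nonneg)
  rw [hc.symm.mul_mul_mul_comm, ← CFC.sqrt_eq_rpow, ← CFC.sqrt_eq_rpow,
    CFC.sqrt_mul_sqrt_self a ha, CFC.sqrt_mul_sqrt_self b hb]

theorem CFC.rpow_mul_rpow_mul_rpow_mul_rpow {a b : 𝒜} (ha : 0 ≤ a) (hb : 0 ≤ b)
    (hau : IsUnit a) (hbu : IsUnit b) (h : Commute a b) (t : ℝ) :
    (a ^ t * b ^ (1 - t)) * (a ^ (1 - t) * b ^ t) = a * b := by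
  rw [(h.cfcRpow (1 - t) (1 - t)).symm.mul_mul_mul_comm, ← CFC.rpow_add hau,
    ← CFC.rpow_add hbu, add_sub_cancel, sub_add_cancel, CFC.rpow_one a ha, CFC.rpow_one b hb]

theorem CFC.continuous_rpow_exponent {a : 𝒜} (ha : IsStrictlyPositive a) :
    Continuous fun t : ℝ ↦ a ^ t := by
  have hpos : ∀ x ∈ spectrum ℝ a, 0 < x :=
    (CStarAlgebra.isStrictlyPositive_iff_isSelfAdjoint_and_spectrum_pos.1 ha).2
  have hcont : ContinuousOn Real.log (spectrum ℝ a) :=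
    Real.continuousOn_log.mono fun x hx ↦ (hpos x hx).ne'
  have heq : ∀ t : ℝ, a ^ t = NormedSpace.exp (t • CFC.log a) := fun t ↦ by
    have hsa : IsSelfAdjoint a := .of_nonneg ha.nonneg
    rw [CFC.log, ← cfc_smul t Real.log a hcont,
      ← CFC.real_exp_eq_normedSpace_exp, ← cfc_comp' Real.exp _ a (by fun_prop) (by fun_prop),
      CFC.rpow_eq_cfc_real ha.nonneg]
    refine cfc_congr fun x hx ↦ ?_
    simp only [Real.rpow_def_of_pos (hpos x hx), smul_eq_mul, mul_comm]
  simp only [heq]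
  let _ : NormedAlgebra ℚ 𝒜 := .restrictScalars ℚ ℝ 𝒜
  have := NormedSpace.exp_continuous (𝔸 := 𝒜)
  fun_prop

theorem ContinuousOn.cfcSqrt {X : Type*} [TopologicalSpace X] {a : X → 𝒜} {s : Set X}
    (ha : ContinuousOn a s) (hnonneg : ∀ x ∈ s, 0 ≤ a x) :
    ContinuousOn (fun x ↦ CFC.sqrt (a x)) s := by
  simp only [CFC.sqrt_eq_cfc]
  exact ha.cfc_nnreal_of_mem_nhdsSet (s := univ) _ univ_mem hnonneg
    NNReal.continuous_sqrt.continuousOn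

/-- Bounds on the spectra of commuting positive elements pass to their weighted geometric mean. -/
theorem CFC.spectrum_rpow_mul_rpow_subset_Icc {a b : 𝒜} (ha : 0 ≤ a) (hb : 0 ≤ b)
    (h : Commute a b) {m M : ℝ} (hm : 0 < m) (hsa : spectrum ℝ a ⊆ Icc m M)
    (hsb : spectrum ℝ b ⊆ Icc m M) {t : ℝ} (ht : t ∈ Icc (0 : ℝ) 1) :
    spectrum ℝ (a ^ t * b ^ (1 - t)) ⊆ Icc m M := by
  nontriviality 𝒜
  obtain ⟨x₀, hx₀⟩ : (spectrum ℝ a).Nonempty :=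
    ContinuousFunctionalCalculus.spectrum_nonempty a (IsSelfAdjoint.of_nonneg ha)
  have hM : 0 < M := hm.trans_le ((hsa hx₀).1.trans (hsa hx₀).2)
  have bounds : ∀ c : 𝒜, 0 ≤ c → spectrum ℝ c ⊆ Icc m M → ∀ u : ℝ, 0 ≤ u →
      algebraMap ℝ 𝒜 (m ^ u) ≤ c ^ u ∧ c ^ u ≤ algebraMap ℝ 𝒜 (M ^ u) := by
    intro c hc hsc u hu
    have hcont : ContinuousOn (fun x : ℝ ↦ x ^ u) (spectrum ℝ c) :=
      (Real.continuous_rpow_const hu).continuousOn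
    have hsa : IsSelfAdjoint c := .of_nonneg hc
    rw [CFC.rpow_eq_cfc_real hc, algebraMap_le_cfc_iff _ _ _ hcont hsa,
      cfc_le_algebraMap_iff _ _ _ hcont hsa]
    exact ⟨fun x hx ↦ Real.rpow_le_rpow hm.le (hsc hx).1 hu,
      fun x hx ↦ Real.rpow_le_rpow (hm.le.trans (hsc hx).1) (hsc hx).2 hu⟩
  have hnonneg : ∀ r : ℝ, 0 ≤ r → (0 : 𝒜) ≤ algebraMap ℝ 𝒜 r := fun r hr ↦
    algebraMap_nonneg 𝒜 hr
  have halg : ∀ r : ℝ, 0 < r →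
      algebraMap ℝ 𝒜 (r ^ t) * algebraMap ℝ 𝒜 (r ^ (1 - t)) = algebraMap ℝ 𝒜 r := fun r hr ↦ by
    rw [← map_mul, ← Real.rpow_add hr, add_sub_cancel, Real.rpow_one]
  have hcomm := h.cfcRpow t (1 - t)
  have hprod : 0 ≤ a ^ t * b ^ (1 - t) := hcomm.mul_nonneg CFC.rpow_nonneg CFC.rpow_nonneg
  obtain ⟨hma, hMa⟩ := bounds a ha hsa t ht.1
  obtain ⟨hmb, hMb⟩ := bounds b hb hsb (1 - t) (sub_nonneg.2 ht.2)
  have hlow : algebraMap ℝ 𝒜 m ≤ a ^ t * b ^ (1 - t) := by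
    rw [← halg m hm]
    exact Commute.cfc_mul_le_mul (hnonneg _ (Real.rpow_nonneg hm.le _)) CFC.rpow_nonneg hma hmb
      (Algebra.commutes _ _) (Algebra.commutes _ _) hcomm
  have hupp : a ^ t * b ^ (1 - t) ≤ algebraMap ℝ 𝒜 M := by
    rw [← halg M hM]
    exact Commute.cfc_mul_le_mul CFC.rpow_nonneg (hnonneg _ (Real.rpow_nonneg hM.le _)) hMa hMb
      hcomm (Algebra.commutes _ _).symm (Algebra.commutes _ _)
  have hsp : IsSelfAdjoint (a ^ t * b ^ (1 - t)) := .of_nonneg hprod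
  exact fun x hx ↦ ⟨(algebraMap_le_iff_le_spectrum hsp).1 hlow x hx,
    (le_algebraMap_iff_spectrum_le hsp).1 hupp x hx⟩

theorem intervalIntegral_mono_on_of_continuousOn {F G : ℝ → 𝒜} {a b : ℝ} (hab : a ≤ b)
    (hF : ContinuousOn F (Icc a b)) (hG : ContinuousOn G (Icc a b))
    (h : ∀ t ∈ Icc a b, F t ≤ G t) :
    ∫ t in a..b, F t ≤ ∫ t in a..b, G t := by
  rw [intervalIntegral.integral_of_le hab, intervalIntegral.integral_of_le hab]
  refine integral_mono_ae (hF.integrableOn_Icc.mono_set Ioc_subset_Icc_self)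
    (hG.integrableOn_Icc.mono_set Ioc_subset_Icc_self) ?_
  filter_upwards [ae_restrict_mem measurableSet_Ioc] with t ht
  exact h t (Ioc_subset_Icc_self ht)

end CStarAlgebra


/-- **Hermite–Hadamard type inequality for operator geometrically convex functions.**
If `f : I → (0,∞)` is continuous and operator geometrically convex, then for
commuting positive invertible `A`, `B` with spectra in `I`:
`f(√(AB)) ≤ ∫_0^1 (f(A^t B^(1−t)) f(A^(1−t) B^t))^(1/2) dt ≤ (f(A) f(B))^(1/2)`. -/
theorem stmt_13 {H : Type*} [NormedAddCommGroup H] [InnerProductSpace ℂ H]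
    [CompleteSpace H] (I : Set ℝ) (hI : I ⊆ Set.Ioi (0 : ℝ)) (hI' : I.OrdConnected)
    (f : ℝ → ℝ) (hfpos : ∀ x ∈ I, 0 < f x) (hfcont : ContinuousOn f I)
    (hogc : ∀ (A B : H →L[ℂ] H), 0 ≤ A → 0 ≤ B → IsUnit A → IsUnit B →
      A * B = B * A → spectrum ℝ A ⊆ I → spectrum ℝ B ⊆ I →
      ∀ l ∈ Set.Icc (0 : ℝ) 1,
        cfc f (A ^ l * B ^ (1 - l)) ≤ (cfc f A) ^ l * (cfc f B) ^ (1 - l))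
    (A B : H →L[ℂ] H) (hA : 0 ≤ A) (hB : 0 ≤ B) (hAu : IsUnit A) (hBu : IsUnit B)
    (hAB : A * B = B * A) (hsA : spectrum ℝ A ⊆ I) (hsB : spectrum ℝ B ⊆ I) :
    cfc f (CFC.sqrt (A * B)) ≤
      (∫ t in (0 : ℝ)..1,
        CFC.sqrt (cfc f (A ^ t * B ^ (1 - t)) * cfc f (A ^ (1 - t) * B ^ t))) ∧
    (∫ t in (0 : ℝ)..1,
        CFC.sqrt (cfc f (A ^ t * B ^ (1 - t)) * cfc f (A ^ (1 - t) * B ^ t))) ≤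
      CFC.sqrt (cfc f A * cfc f B) := by
  rcases subsingleton_or_nontrivial (H →L[ℂ] H) with hsub | hnontriv
  · exact ⟨(Subsingleton.elim _ _).le, (Subsingleton.elim _ _).le⟩
  have hcomm : Commute A B := hAB
  obtain ⟨m, hmI, M, -, hA', hB', hmM⟩ :=
    (IsSelfAdjoint.of_nonneg hA).exists_spectrum_subset_Icc_subset hI' hsA hsB
  have hm : 0 < m := hI hmI
  -- The family of weighted geometric means of `A` and `B`; the partner of `P t` is `P (1 - t)`.
  set P : ℝ → H →L[ℂ] H := fun t ↦ A ^ t * B ^ (1 - t) with hP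
  have hPflip : ∀ t, A ^ (1 - t) * B ^ t = P (1 - t) := fun t ↦ by simp [hP]
  have hflip : ∀ t ∈ Icc (0 : ℝ) 1, 1 - t ∈ Icc (0 : ℝ) 1 := fun t ht ↦
    ⟨sub_nonneg.2 ht.2, sub_le_self _ ht.1⟩
  have hPnonneg : ∀ t, 0 ≤ P t := fun t ↦
    (hcomm.cfcRpow t (1 - t)).mul_nonneg CFC.rpow_nonneg CFC.rpow_nonneg
  have hPunit : ∀ t, IsUnit (P t) := fun t ↦ (hAu.cfcRpow t hA).mul (hBu.cfcRpow (1 - t) hB)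
  have hPspec : ∀ t ∈ Icc (0 : ℝ) 1, spectrum ℝ (P t) ⊆ Icc m M := fun t ht ↦
    CFC.spectrum_rpow_mul_rpow_subset_Icc hA hB hcomm hm hA' hB' ht
  have hPcomm : ∀ C : H →L[ℂ] H, Commute A C → Commute B C → ∀ t, Commute (P t) C :=
    fun C hAC hBC t ↦ (hAC.cfc_nnreal _).mul_left (hBC.cfc_nnreal _)
  have hPA : ∀ t, Commute (P t) A := hPcomm A (.refl A) hcomm.symm
  have hPB : ∀ t, Commute (P t) B := hPcomm B hcomm (.refl B)
  have hPP : ∀ s t, Commute (P s) (P t) := fun s t ↦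
    hPcomm (P t) (hPA t).symm (hPB t).symm s
  have hPmul : ∀ t, P t * P (1 - t) = A * B := fun t ↦ by
    rw [← hPflip]
    exact CFC.rpow_mul_rpow_mul_rpow_mul_rpow hA hB hAu hBu hcomm t
  have hfcomm : ∀ {C D : H →L[ℂ] H}, Commute C D → Commute (cfc f C) (cfc f D) := fun h ↦
    ((h.cfc_real f).symm.cfc_real f).symm
  have hfnonneg : ∀ {C : H →L[ℂ] H}, spectrum ℝ C ⊆ I → 0 ≤ cfc f C := fun h ↦
    cfc_nonneg fun x hx ↦ (hfpos x (h hx)).le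
  have hfunit : ∀ {C : H →L[ℂ] H}, 0 ≤ C → spectrum ℝ C ⊆ I → IsUnit (cfc f C) := fun h0 h ↦
    (isUnit_cfc_iff f _ (hfcont.mono h) (.of_nonneg h0)).2 fun x hx ↦ (hfpos x (h hx)).ne'
  have hPI : ∀ t ∈ Icc (0 : ℝ) 1, spectrum ℝ (P t) ⊆ I := fun t ht ↦ (hPspec t ht).trans hmM
  have hPcont : Continuous P :=
    (CFC.continuous_rpow_exponent (hAu.isStrictlyPositive hA)).mul
      ((CFC.continuous_rpow_exponent (hBu.isStrictlyPositive hB)).comp (by fun_prop))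
  have hfP : ContinuousOn (fun t ↦ cfc f (P t)) (Icc 0 1) :=
    ContinuousOn.cfc' isCompact_Icc f hPcont.continuousOn hPspec
      (fun t _ ↦ .of_nonneg (hPnonneg t)) (hfcont.mono hmM)
  have hfPnonneg : ∀ t ∈ Icc (0 : ℝ) 1, 0 ≤ cfc f (P t) := fun t ht ↦ hfnonneg (hPI t ht)
  have hint : ContinuousOn (fun t ↦ CFC.sqrt (cfc f (P t) * cfc f (P (1 - t)))) (Icc 0 1) :=
    (hfP.mul (hfP.comp (f := fun t : ℝ ↦ 1 - t) (by fun_prop) hflip)).cfcSqrt fun t ht ↦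
      (hfcomm (hPP t (1 - t))).mul_nonneg (hfPnonneg t ht) (hfPnonneg _ (hflip t ht))
  have hlower : ∀ t ∈ Icc (0 : ℝ) 1,
      cfc f (CFC.sqrt (A * B)) ≤ CFC.sqrt (cfc f (P t) * cfc f (P (1 - t))) := fun t ht ↦ by
    have ht' := hflip t ht
    have key := hogc (P t) (P (1 - t)) (hPnonneg t) (hPnonneg _) (hPunit t) (hPunit _)
      (hPP t (1 - t)) (hPI t ht) (hPI _ ht') (1 / 2) ⟨by norm_num, by norm_num⟩
    rw [show (1 : ℝ) - 1 / 2 = 1 / 2 by norm_num] at key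
    rwa [← hPmul t, CFC.sqrt_mul_of_commute (hPnonneg t) (hPnonneg _) (hPP t (1 - t)),
      CFC.sqrt_mul_of_commute (hfPnonneg t ht) (hfPnonneg _ ht') (hfcomm (hPP t (1 - t)))]
  have hfPcomm : ∀ s t : ℝ, Commute (cfc f (P s)) (cfc f A ^ t * cfc f B ^ (1 - t)) := fun s t ↦
    ((hfcomm (hPA s)).symm.cfc_nnreal _).symm.mul_right
      ((hfcomm (hPB s)).symm.cfc_nnreal _).symm
  have hfAB : Commute (cfc f A) (cfc f B) := hfcomm hcomm
  have hfle : ∀ t ∈ Icc (0 : ℝ) 1, cfc f (P t) ≤ cfc f A ^ t * cfc f B ^ (1 - t) :=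
    hogc A B hA hB hAu hBu hAB hsA hsB
  have hupper : ∀ t ∈ Icc (0 : ℝ) 1,
      CFC.sqrt (cfc f (P t) * cfc f (P (1 - t))) ≤ CFC.sqrt (cfc f A * cfc f B) := fun t ht ↦ by
    refine CFC.sqrt_le_sqrt _ _ ?_
    rw [← CFC.rpow_mul_rpow_mul_rpow_mul_rpow (hfnonneg hsA) (hfnonneg hsB) (hfunit hA hsA)
      (hfunit hB hsB) hfAB t]
    have hle := hfle (1 - t) (hflip t ht)
    have hcommR := hfPcomm t (1 - t)
    rw [sub_sub_cancel] at hle hcommR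
    refine Commute.cfc_mul_le_mul (hfPnonneg t ht)
      ((hfAB.cfcRpow _ _).mul_nonneg CFC.rpow_nonneg CFC.rpow_nonneg) (hfle t ht) hle
      (hfcomm (hPP _ _)) hcommR ?_
    exact (((Commute.refl _).cfcRpow _ _).mul_right (hfAB.cfcRpow _ _)).mul_left
      ((hfAB.symm.cfcRpow _ _).mul_right ((Commute.refl _).cfcRpow _ _))
  simp only [hPflip]
  constructor
  · simpa using intervalIntegral_mono_on_of_continuousOn zero_le_one continuousOn_const hint hlower
  · simpa using intervalIntegral_mono_on_of_continuousOn zero_le_one hint continuousOn_const hupper
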